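/- arXiv:2602.05291 — 9 statements merged into one kernel-verified Lean document; each statement's English description precedes it below -/
import Mathlib

section
/- Aspirational dampening: Fix a nonempty subset S of a finite set X, a distribution p₀ on S, and α ∈ (0,1). Let q and q' be exposures with q_S > 0, q'_S > 0, and identical within-feasible compositions: q(x | S) = q'(x | S) for all x ∈ S. Then (i) for every x ∈ S, p(x | S; q', α) - p(x | S; q, α) = (β(q'_S) - β(q_S))·(q(x | S) - p₀(x)); (ii) for every exposure q with q_S > 0 and every x ∈ S, p(x | S; q, α) - p₀(x) = β(q_S)·(q(x | S) - p₀(x)); and (iii) if q'_S < q_S then β(q'_S) < β(q_S), where β(μ) := α·μ/((1-α)+α·μ). -/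
/-- The effective influence weight `α * m / ((1 - α) + α * m)` of a mixture describes
the displacement of the mixed choice from the baseline `b`. -/
lemma mixture_sub_baseline {α m : ℝ} (b c : ℝ) (hα0 : 0 < α) (hα1 : α < 1) (hm : 0 < m) :
    ((1 - α) * b + α * c) / ((1 - α) + α * m) - b
      = (α * m / ((1 - α) + α * m)) * (c / m - b) := by
  have hden : (1 - α) + α * m ≠ 0 := by
    have := mul_pos hα0 hm
    linarith
  field_simp
  ring

/-- The effective influence weight is strictly increasing in the feasible share. -/
lemma influenceWeight_lt {α m m' : ℝ} (hα0 : 0 < α) (hα1 : α < 1) (hm' : 0 < m')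
    (h : m' < m) :
    α * m' / ((1 - α) + α * m') < α * m / ((1 - α) + α * m) := by
  have h1 := mul_pos hα0 hm'
  have h2 := mul_lt_mul_of_pos_left h hα0
  rw [div_lt_div_iff₀ (by linarith) (by linarith)]
  have h3 := mul_lt_mul_of_pos_left h2 (sub_pos.mpr hα1)
  linarith

/-- **Aspirational dampening.** With `β(μ) = α·μ/((1-α)+α·μ)`:
(i) if two exposures `q, q'` have positive feasible shares and identical
within-feasible compositions, then the difference of the AWLM choices equals
`(β(q'_S) - β(q_S))·(q(x|S) - p₀(x))`;
(ii) for every exposure with positive feasible share,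
`p(x|S;q,α) - p₀(x) = β(q_S)·(q(x|S) - p₀(x))`;
(iii) if `q'_S < q_S` then `β(q'_S) < β(q_S)`. -/
theorem aspirational_dampening
    {X : Type*} [Fintype X] (S : Finset X) (hS : S.Nonempty)
    (α : ℝ) (hα0 : 0 < α) (hα1 : α < 1)
    (p0 : X → ℝ) (hp0nn : ∀ x ∈ S, 0 ≤ p0 x) (hp0sum : ∑ x ∈ S, p0 x = 1) :
    (∀ q q' : X → ℝ,
      (∀ x, 0 ≤ q x) → (∑ x, q x = 1) →
      (∀ x, 0 ≤ q' x) → (∑ x, q' x = 1) →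
      0 < ∑ y ∈ S, q y → 0 < ∑ y ∈ S, q' y →
      (∀ x ∈ S, q x / ∑ y ∈ S, q y = q' x / ∑ y ∈ S, q' y) →
      ∀ x ∈ S,
        ((1 - α) * p0 x + α * q' x) / ((1 - α) + α * ∑ y ∈ S, q' y)
          - ((1 - α) * p0 x + α * q x) / ((1 - α) + α * ∑ y ∈ S, q y)
        = (α * (∑ y ∈ S, q' y) / ((1 - α) + α * ∑ y ∈ S, q' y)
            - α * (∑ y ∈ S, q y) / ((1 - α) + α * ∑ y ∈ S, q y))
          * (q x / (∑ y ∈ S, q y) - p0 x)) ∧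
    (∀ q : X → ℝ,
      (∀ x, 0 ≤ q x) → (∑ x, q x = 1) → 0 < ∑ y ∈ S, q y →
      ∀ x ∈ S,
        ((1 - α) * p0 x + α * q x) / ((1 - α) + α * ∑ y ∈ S, q y) - p0 x
        = (α * (∑ y ∈ S, q y) / ((1 - α) + α * ∑ y ∈ S, q y))
          * (q x / (∑ y ∈ S, q y) - p0 x)) ∧
    (∀ q q' : X → ℝ,
      (∀ x, 0 ≤ q x) → (∑ x, q x = 1) →
      (∀ x, 0 ≤ q' x) → (∑ x, q' x = 1) →
      0 < ∑ y ∈ S, q y → 0 < ∑ y ∈ S, q' y →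
      (∑ y ∈ S, q' y) < (∑ y ∈ S, q y) →
      α * (∑ y ∈ S, q' y) / ((1 - α) + α * ∑ y ∈ S, q' y)
        < α * (∑ y ∈ S, q y) / ((1 - α) + α * ∑ y ∈ S, q y)) := by
  refine ⟨?_, ?_, ?_⟩
  · intro q q' _ _ _ _ hq hq' hcomp x hx
    have h1 := mixture_sub_baseline (p0 x) (q x) hα0 hα1 hq
    have h2 := mixture_sub_baseline (p0 x) (q' x) hα0 hα1 hq'
    rw [← hcomp x hx] at h2
    linear_combination h2 - h1
  · intro q _ _ hq x _
    exact mixture_sub_baseline (p0 x) (q x) hα0 hα1 hq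
  · intro q q' _ _ _ _ _ hq' h
    exact influenceWeight_lt hα0 hα1 hq' h
end

section
/- Controlled multiplier and level-affine form: Let S be a finite set with |S| ≥ 3 and let μ ∈ (0,1). Let V_μ := { v : S → ℝ : v(x) ≥ 0 for all x and ∑_{x∈S} v(x) = μ }, and let P : V_μ → Δ(S) (where Δ(S) is the set of distributions on S) be a map satisfying the proportional-response condition: for all v₁, v₂ ∈ V_μ and all x, y ∈ S, (P(v₁)(x) - P(v₂)(x))·(v₁(y) - v₂(y)) = (P(v₁)(y) - P(v₂)(y))·(v₁(x) - v₂(x)). Then there exist a unique scalar λ ∈ ℝ and a unique vector a : S → ℝ such that P(v)(x) = a(x) + λ·v(x) for all v ∈ V_μ and all x ∈ S. -/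
/-- A vector `d` proportional to `w` is an explicit multiple of `w`, given a coordinate `i`
at which `w` does not vanish. -/
theorem eq_div_mul_of_proportional {S : Type*} {d w : S → ℝ} {i : S} (hi : w i ≠ 0)
    (h : ∀ x y, d x * w y = d y * w x) (x : S) : d x = d i / w i * w x := by
  rw [div_mul_eq_mul_div, eq_div_iff hi, h x i]

/-- A vector proportional to the displacements of `v` from three distinct scaled
coordinate vectors vanishes. -/
theorem eq_zero_of_proportional_sub_single {S : Type*} [DecidableEq S] {m : ℝ} (hm : m ≠ 0)
    {d v : S → ℝ} {i j k : S} (hij : i ≠ j) (hik : i ≠ k) (hjk : j ≠ k)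
    (h : ∀ l, l = i ∨ l = j ∨ l = k → ∀ x y,
      d x * (v y - (Pi.single l m : S → ℝ) y) =
        d y * (v x - (Pi.single l m : S → ℝ) x)) (x : S) : d x = 0 := by
  have key : ∀ p q : S, (p = i ∨ p = j ∨ p = k) → (q = i ∨ q = j ∨ q = k) → p ≠ q →
      x ≠ p → x ≠ q → d x = 0 := by
    intro p q hp hq hpq hxp hxq
    have h₁ := h p hp x p
    have h₂ := h q hq x p
    simp only [Pi.single_eq_same, Pi.single_eq_of_ne hxp, Pi.single_eq_of_ne hxq,
      Pi.single_eq_of_ne hpq] at h₁ h₂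
    have h₃ : d x * m = 0 := by linarith
    exact (mul_eq_zero.mp h₃).resolve_right hm
  by_cases hxi : x = i
  · subst hxi
    exact key j k (by simp) (by simp) hjk hij hik
  by_cases hxj : x = j
  · subst hxj
    exact key i k (by simp) (by simp) hik hxi hjk
  · exact key i j (by simp) (by simp) hij hxi hxj

/-- **Controlled multiplier and level-affine form.** Let `S` be a finite set with
`|S| ≥ 3` and `μ ∈ (0,1)`. If `P` maps every `v ∈ V_μ` (nonnegative, total mass `μ`)
to a distribution on `S` and satisfies the proportional-response condition, then there
exist a unique scalar `λ` and a unique vector `a : S → ℝ` with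
`P(v)(x) = a(x) + λ·v(x)` for all `v ∈ V_μ` and all `x ∈ S`. -/
theorem controlled_multiplier_level_affine
    {S : Type*} [Fintype S] (hcard : 3 ≤ Fintype.card S)
    (μ : ℝ) (hμ : μ ∈ Set.Ioo (0 : ℝ) 1)
    (P : (S → ℝ) → (S → ℝ))
    (hPdist : ∀ v : S → ℝ, (∀ x, 0 ≤ v x) → (∑ x, v x = μ) →
      (∀ x, 0 ≤ P v x) ∧ (∑ x, P v x = 1))
    (hprop : ∀ v₁ v₂ : S → ℝ,
      (∀ x, 0 ≤ v₁ x) → (∑ x, v₁ x = μ) →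
      (∀ x, 0 ≤ v₂ x) → (∑ x, v₂ x = μ) →
      ∀ x y : S,
        (P v₁ x - P v₂ x) * (v₁ y - v₂ y) = (P v₁ y - P v₂ y) * (v₁ x - v₂ x)) :
    ∃! la : ℝ × (S → ℝ),
      ∀ v : S → ℝ, (∀ x, 0 ≤ v x) → (∑ x, v x = μ) →
        ∀ x, P v x = la.2 x + la.1 * v x := by
  classical
  obtain ⟨i, j, k, hij, hik, hjk⟩ := Fintype.two_lt_card_iff.mp hcard
  have hm : μ ≠ 0 := hμ.1.ne'
  have e_nonneg : ∀ l x, 0 ≤ (Pi.single l μ : S → ℝ) x := fun l x =>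
    (Pi.single_nonneg.mpr hμ.1.le : (0 : S → ℝ) ≤ Pi.single l μ) x
  have e_sum : ∀ l, ∑ x, (Pi.single l μ : S → ℝ) x = μ := fun l => by simp
  have edge : ∀ p q : S, p ≠ q → ∃ c : ℝ, ∀ x,
      P (Pi.single p μ) x - P (Pi.single q μ) x =
        c * ((Pi.single p μ : S → ℝ) x - (Pi.single q μ : S → ℝ) x) := by
    intro p q hpq
    refine ⟨_, eq_div_mul_of_proportional
      (d := fun x => P (Pi.single p μ) x - P (Pi.single q μ) x)
      (w := fun x => (Pi.single p μ : S → ℝ) x - (Pi.single q μ : S → ℝ) x)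
      (i := p) ?_ (hprop _ _ (e_nonneg p) (e_sum p) (e_nonneg q) (e_sum q))⟩
    simpa [Pi.single_eq_of_ne hpq] using hm
  obtain ⟨c, hc⟩ := edge i j hij
  obtain ⟨c₁, hc₁⟩ := edge i k hik
  obtain ⟨c₂, hc₂⟩ := edge j k hjk
  have hcc₁ : c₁ = c := by
    have h₁ := hc i
    have h₂ := hc₁ i
    have h₃ := hc₂ i
    simp only [Pi.single_eq_same, Pi.single_eq_of_ne hij, Pi.single_eq_of_ne hik] at h₁ h₂ h₃
    exact mul_right_cancel₀ hm (by linarith)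
  subst hcc₁
  refine ⟨(c₁, fun x => P (Pi.single i μ) x - c₁ * (Pi.single i μ : S → ℝ) x), ?_, ?_⟩
  · intro v hv hvs x
    have vertex : ∀ l, l = i ∨ l = j ∨ l = k → ∀ y,
        P (Pi.single l μ) y - c₁ * (Pi.single l μ : S → ℝ) y =
          P (Pi.single i μ) y - c₁ * (Pi.single i μ : S → ℝ) y := by
      rintro l (rfl | rfl | rfl) y
      · rfl
      · linarith [hc y]
      · linarith [hc₁ y]
    have hzero := eq_zero_of_proportional_sub_single hm (v := v)
      (d := fun y => P v y - c₁ * v y - (P (Pi.single i μ) y - c₁ * (Pi.single i μ : S → ℝ) y))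
      hij hik hjk (fun l hl y z => by
        rw [← vertex l hl y, ← vertex l hl z]
        linear_combination hprop v _ hv hvs (e_nonneg l) (e_sum l) y z) x
    dsimp only at hzero ⊢
    linarith
  · rintro ⟨b, a⟩ h
    have hi := h _ (e_nonneg i) (e_sum i)
    have hj := h _ (e_nonneg j) (e_sum j)
    have hb : b = c₁ := by
      have h₁ := hc i
      have h₂ := hi i
      have h₃ := hj i
      simp only [Pi.single_eq_same, Pi.single_eq_of_ne hij] at h₁ h₂ h₃
      exact mul_right_cancel₀ hm (by linarith)
    subst hb
    refine Prod.ext rfl (funext fun x => ?_)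
    have h₂ := hi x
    dsimp only at h₂ ⊢
    linarith
end

section
/- AWLM satisfies radial consistency: Fix a nonempty subset S of a finite set X, α ∈ (0,1), and a distribution p₀ on S. Let q₁, q₂ be exposures with q₁,S > 0, q₂,S > 0, and identical within-feasible composition v(x) := q₁(x | S) = q₂(x | S) for x ∈ S. Then for i = 1, 2, p(x | S; qᵢ, α) - v(x) = (1 - β(q_{i,S}))·(p₀(x) - v(x)) for all x ∈ S, where β(μ) := α·μ/((1-α)+α·μ); consequently, for all x, y ∈ S, (p(x | S; q₁, α) - v(x))·(p(y | S; q₂, α) - v(y)) = (p(y | S; q₁, α) - v(y))·(p(x | S; q₂, α) - v(x)). -/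
/-- Mixing `p` with an exposure of mass `m` and composition `q / m` moves `p` towards that
composition by the fraction `β = α * m / ((1 - α) + α * m)`. -/
lemma awlm_sub_composition {α m p q : ℝ} (hm : m ≠ 0) (hd : (1 - α) + α * m ≠ 0) :
    ((1 - α) * p + α * q) / ((1 - α) + α * m) - q / m
      = (1 - α * m / ((1 - α) + α * m)) * (p - q / m) := by
  field_simp
  ring

/-- **AWLM satisfies radial consistency.** If two exposures `q₁, q₂` have positive
feasible shares and identical within-feasible composition `v`, then for each `i`,
`p(x|S;qᵢ,α) - v(x) = (1 - β(q_{i,S}))·(p₀(x) - v(x))` with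
`β(μ) = α·μ/((1-α)+α·μ)`; consequently the vectors `p(·|S;q₁,α) - v` and
`p(·|S;q₂,α) - v` are collinear in the determinant sense. -/
theorem AWLM_radial_consistency
    {X : Type*} [Fintype X] (S : Finset X) (hS : S.Nonempty)
    (α : ℝ) (hα0 : 0 < α) (hα1 : α < 1)
    (p0 : X → ℝ) (hp0nn : ∀ x ∈ S, 0 ≤ p0 x) (hp0sum : ∑ x ∈ S, p0 x = 1)
    (q₁ q₂ : X → ℝ)
    (hq₁nn : ∀ x, 0 ≤ q₁ x) (hq₁sum : ∑ x, q₁ x = 1)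
    (hq₂nn : ∀ x, 0 ≤ q₂ x) (hq₂sum : ∑ x, q₂ x = 1)
    (hq₁S : 0 < ∑ y ∈ S, q₁ y) (hq₂S : 0 < ∑ y ∈ S, q₂ y)
    (v : X → ℝ)
    (hv₁ : ∀ x ∈ S, v x = q₁ x / ∑ y ∈ S, q₁ y)
    (hv₂ : ∀ x ∈ S, v x = q₂ x / ∑ y ∈ S, q₂ y) :
    (∀ x ∈ S,
      ((1 - α) * p0 x + α * q₁ x) / ((1 - α) + α * ∑ y ∈ S, q₁ y) - v x
        = (1 - α * (∑ y ∈ S, q₁ y) / ((1 - α) + α * ∑ y ∈ S, q₁ y))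
          * (p0 x - v x)) ∧
    (∀ x ∈ S,
      ((1 - α) * p0 x + α * q₂ x) / ((1 - α) + α * ∑ y ∈ S, q₂ y) - v x
        = (1 - α * (∑ y ∈ S, q₂ y) / ((1 - α) + α * ∑ y ∈ S, q₂ y))
          * (p0 x - v x)) ∧
    (∀ x ∈ S, ∀ y ∈ S,
      (((1 - α) * p0 x + α * q₁ x) / ((1 - α) + α * ∑ z ∈ S, q₁ z) - v x)
        * (((1 - α) * p0 y + α * q₂ y) / ((1 - α) + α * ∑ z ∈ S, q₂ z) - v y)
      = (((1 - α) * p0 y + α * q₁ y) / ((1 - α) + α * ∑ z ∈ S, q₁ z) - v y)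
        * (((1 - α) * p0 x + α * q₂ x) / ((1 - α) + α * ∑ z ∈ S, q₂ z) - v x)) := by
  have radial (q : X → ℝ) (hq : 0 < ∑ y ∈ S, q y)
      (hv : ∀ x ∈ S, v x = q x / ∑ y ∈ S, q y) (x : X) (hx : x ∈ S) :
      ((1 - α) * p0 x + α * q x) / ((1 - α) + α * ∑ y ∈ S, q y) - v x
        = (1 - α * (∑ y ∈ S, q y) / ((1 - α) + α * ∑ y ∈ S, q y)) * (p0 x - v x) := by
    rw [hv x hx]
    exact awlm_sub_composition hq.ne' (add_pos (sub_pos.2 hα1) (mul_pos hα0 hq)).ne'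
  refine ⟨radial q₁ hq₁S hv₁, radial q₂ hq₂S hv₂, fun x hx y hy => ?_⟩
  rw [radial q₁ hq₁S hv₁ x hx, radial q₁ hq₁S hv₁ y hy,
    radial q₂ hq₂S hv₂ x hx, radial q₂ hq₂S hv₂ y hy]
  ring
end

section
/- Per-menu AWLM characterization (sufficiency of the axioms): Let X be a finite set, S ⊆ X with |S| ≥ 3 and S ≠ X, and let p(· | S; ·) assign to each exposure q on X a distribution on S. Suppose: (A1-i) if q₁(x) = q₂(x) for all x ∈ S and q₁,S = q₂,S ∈ (0,1), then p(· | S; q₁) = p(· | S; q₂); (A1-ii) for all exposures q₁, q₂ with q₁,S = q₂,S = μ ∈ (0,1) and all x, y ∈ S, (p(x|S;q₁) - p(x|S;q₂))·(q₁(y) - q₂(y)) = (p(y|S;q₁) - p(y|S;q₂))·(q₁(x) - q₂(x)); (A2-i) the level multipliers λ(μ) given by A1 satisfy 1/λ(μ₁) - 1/λ(μ₂) = μ₁ - μ₂ for all μ₁, μ₂ ∈ (0,1) and 1/λ(μ) > μ for all μ ∈ (0,1); (A2-ii) for any exposures q₁, q₂ with q₁,S, q₂,S ∈ (0,1) and equal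 within-feasible compositions v, the vectors p(·|S;q₁) - v and p(·|S;q₂) - v are collinear: (p(x|S;q₁) - v(x))·(p(y|S;q₂) - v(y)) = (p(y|S;q₁) - v(y))·(p(x|S;q₂) - v(x)) for all x, y ∈ S. Then there exist α ∈ (0,1) and a distribution p₀ on S such that for every exposure q with q_S ∈ (0,1) and every x ∈ S, p(x | S; q) = ((1-α)·p₀(x) + α·q(x)) / ((1-α) + α·q_S); moreover α = 1/(1+κ) where κ := 1/λ(μ̄) - μ̄ for any μ̄ ∈ (0,1). -/
/-- An exposure on a finite universe `X`: nonnegative and summing to one. -/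
def IsExposure {X : Type*} [Fintype X] (q : X → ℝ) : Prop :=
  (∀ x, 0 ≤ q x) ∧ ∑ x, q x = 1

/-- The exposure putting mass `μ` on `z` and the remaining mass `1 - μ` on `w`. -/
noncomputable def twoPointExposure {X : Type*} (w : X) (μ : ℝ) (z x : X) : ℝ :=
  open Classical in μ * (if x = z then 1 else 0) + (1 - μ) * (if x = w then 1 else 0)

lemma isExposure_twoPointExposure {X : Type*} [Fintype X] (w z : X) {μ : ℝ}
    (hμ : μ ∈ Set.Icc (0 : ℝ) 1) : IsExposure (twoPointExposure w μ z) := by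
  classical
  refine ⟨fun x => ?_, ?_⟩
  · have h₀ := hμ.1
    have h₁ := sub_nonneg.2 hμ.2
    unfold twoPointExposure
    positivity
  · simp [twoPointExposure, Finset.sum_add_distrib]

open Classical in
lemma twoPointExposure_of_mem {X : Type*} {S : Finset X} {w x : X} (hw : w ∉ S) (hx : x ∈ S)
    (μ : ℝ) (z : X) : twoPointExposure w μ z x = μ * (if x = z then 1 else 0) := by
  have hxw : x ≠ w := fun h => hw (h ▸ hx)
  simp [twoPointExposure, hxw]

lemma sum_twoPointExposure {X : Type*} {S : Finset X} {w z : X} (hw : w ∉ S) (hz : z ∈ S)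
    (μ : ℝ) : ∑ x ∈ S, twoPointExposure w μ z x = μ := by
  classical
  rw [Finset.sum_congr rfl fun x hx => twoPointExposure_of_mem hw hx μ z]
  simp [hz]

open Classical in
/-- Two vectors that are collinear as seen from every vertex of a simplex with at least three
vertices coincide. -/
lemma eq_of_collinear_from_vertices {X : Type*} {S : Finset X} (hcard : 3 ≤ S.card)
    {r₁ r₂ : X → ℝ}
    (h : ∀ z ∈ S, ∀ x ∈ S, ∀ y ∈ S,
      (r₁ x - if x = z then 1 else 0) * (r₂ y - if y = z then 1 else 0)
        = (r₁ y - if y = z then 1 else 0) * (r₂ x - if x = z then 1 else 0)) :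
    ∀ x ∈ S, r₁ x = r₂ x := by
  intro x hx
  obtain ⟨y, hy, hyx⟩ := Finset.exists_mem_ne (show 1 < S.card by omega) x
  obtain ⟨z, hz⟩ : ((S.erase x).erase y).Nonempty := by
    rw [← Finset.card_pos, Finset.card_erase_of_mem (Finset.mem_erase.2 ⟨hyx, hy⟩),
      Finset.card_erase_of_mem hx]
    omega
  simp only [Finset.mem_erase] at hz
  obtain ⟨hzy, hzx, hz⟩ := hz
  have hfar := h z hz x hx y hy
  have hnear := h y hy x hx y hy
  simp only [hzy.symm, hzx.symm, hyx.symm, if_true, if_false] at hfar hnear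
  linarith

/-- **Per-menu AWLM characterization (sufficiency of the axioms).** Let `S ⊆ X` with
`|S| ≥ 3` and `S ≠ X`, and let `p` assign to each exposure a distribution on `S`.
Under (A1-i) intra-aspiration irrelevance, (A1-ii) proportional response, (A2-i) the
leverage-line condition on the level multipliers `lam μ`, and (A2-ii) radial
consistency, there exist `α ∈ (0,1)` and a distribution `p₀` on `S` such that the
AWLM formula holds for every exposure with feasible share in `(0,1)`; moreover
`α = 1/(1+κ)` where `κ = 1/lam(μ̄) - μ̄` for any `μ̄ ∈ (0,1)`. -/
theorem per_menu_AWLM_characterization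
    {X : Type*} [Fintype X] (S : Finset X)
    (hcard : 3 ≤ S.card) (hne : S ≠ Finset.univ)
    (p : (X → ℝ) → X → ℝ)
    (hdist : ∀ q : X → ℝ, IsExposure q →
      (∀ x ∈ S, 0 ≤ p q x) ∧ (∑ x ∈ S, p q x = 1))
    (hA1i : ∀ q₁ q₂ : X → ℝ, IsExposure q₁ → IsExposure q₂ →
      (∀ x ∈ S, q₁ x = q₂ x) →
      (∑ y ∈ S, q₁ y) ∈ Set.Ioo (0 : ℝ) 1 →
      (∑ y ∈ S, q₂ y) ∈ Set.Ioo (0 : ℝ) 1 →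
      ∀ x ∈ S, p q₁ x = p q₂ x)
    (hA1ii : ∀ μ ∈ Set.Ioo (0 : ℝ) 1, ∀ q₁ q₂ : X → ℝ,
      IsExposure q₁ → IsExposure q₂ →
      (∑ y ∈ S, q₁ y = μ) → (∑ y ∈ S, q₂ y = μ) →
      ∀ x ∈ S, ∀ y ∈ S,
        (p q₁ x - p q₂ x) * (q₁ y - q₂ y) = (p q₁ y - p q₂ y) * (q₁ x - q₂ x))
    (lam : ℝ → ℝ)
    (hlam : ∀ μ ∈ Set.Ioo (0 : ℝ) 1, ∀ q₁ q₂ : X → ℝ,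
      IsExposure q₁ → IsExposure q₂ →
      (∑ y ∈ S, q₁ y = μ) → (∑ y ∈ S, q₂ y = μ) →
      ∀ x ∈ S, p q₁ x - p q₂ x = lam μ * (q₁ x - q₂ x))
    (hA2i : (∀ μ₁ ∈ Set.Ioo (0 : ℝ) 1, ∀ μ₂ ∈ Set.Ioo (0 : ℝ) 1,
        1 / lam μ₁ - 1 / lam μ₂ = μ₁ - μ₂) ∧
      (∀ μ ∈ Set.Ioo (0 : ℝ) 1, μ < 1 / lam μ))
    (hA2ii : ∀ q₁ q₂ : X → ℝ, IsExposure q₁ → IsExposure q₂ →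
      (∑ y ∈ S, q₁ y) ∈ Set.Ioo (0 : ℝ) 1 →
      (∑ y ∈ S, q₂ y) ∈ Set.Ioo (0 : ℝ) 1 →
      (∀ x ∈ S, q₁ x / ∑ y ∈ S, q₁ y = q₂ x / ∑ y ∈ S, q₂ y) →
      ∀ x ∈ S, ∀ y ∈ S,
        (p q₁ x - q₁ x / ∑ z ∈ S, q₁ z) * (p q₂ y - q₁ y / ∑ z ∈ S, q₁ z)
          = (p q₁ y - q₁ y / ∑ z ∈ S, q₁ z) * (p q₂ x - q₁ x / ∑ z ∈ S, q₁ z)) :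
    ∃ α ∈ Set.Ioo (0 : ℝ) 1, ∃ p0 : X → ℝ,
      (∀ x ∈ S, 0 ≤ p0 x) ∧ (∑ x ∈ S, p0 x = 1) ∧
      (∀ q : X → ℝ, IsExposure q → (∑ y ∈ S, q y) ∈ Set.Ioo (0 : ℝ) 1 →
        ∀ x ∈ S,
          p q x = ((1 - α) * p0 x + α * q x) / ((1 - α) + α * ∑ y ∈ S, q y)) ∧
      (∀ μ ∈ Set.Ioo (0 : ℝ) 1, α = 1 / (1 + (1 / lam μ - μ))) := by
  classical
  obtain ⟨w, hw⟩ : ∃ w, w ∉ S := by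
    by_contra! h
    exact hne (Finset.eq_univ_iff_forall.2 h)
  obtain ⟨s, hs⟩ : S.Nonempty := Finset.card_pos.1 (by omega)
  have half_mem : (1 / 2 : ℝ) ∈ Set.Ioo (0 : ℝ) 1 := by constructor <;> norm_num
  obtain ⟨κ, hκ⟩ : ∃ κ, κ = 1 / lam (1 / 2) - 1 / 2 := ⟨_, rfl⟩
  have hκ_pos : 0 < κ := by
    have := hA2i.2 _ half_mem
    linarith
  have inv_lam : ∀ μ ∈ Set.Ioo (0 : ℝ) 1, 1 / lam μ = μ + κ := fun μ hμ => by
    have := hA2i.1 μ hμ _ half_mem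
    linarith
  have lam_eq : ∀ μ ∈ Set.Ioo (0 : ℝ) 1, lam μ = 1 / (μ + κ) := fun μ hμ => by
    rw [← inv_lam μ hμ, one_div_one_div]
  have exposure : ∀ μ ∈ Set.Ioo (0 : ℝ) 1, ∀ z, IsExposure (twoPointExposure w μ z) :=
    fun μ hμ z => isExposure_twoPointExposure w z (Set.Ioo_subset_Icc_self hμ)
  obtain ⟨r, hr⟩ : ∃ r : ℝ → X → ℝ, ∀ μ x,
      r μ x = ((μ + κ) * p (twoPointExposure w μ s) x - twoPointExposure w μ s x) / κ :=
    ⟨_, fun _ _ => rfl⟩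
  have p_eq : ∀ q, IsExposure q → (∑ y ∈ S, q y) ∈ Set.Ioo (0 : ℝ) 1 → ∀ x ∈ S,
      p q x = (κ * r (∑ y ∈ S, q y) x + q x) / (∑ y ∈ S, q y + κ) := by
    intro q hq hμ x hx
    have hpos : 0 < ∑ y ∈ S, q y + κ := add_pos hμ.1 hκ_pos
    have h := hlam _ hμ q _ hq (exposure _ hμ s) rfl (sum_twoPointExposure hw hs _) x hx
    rw [lam_eq _ hμ] at h
    rw [hr]
    field_simp at h ⊢
    linarith
  have p_twoPoint : ∀ μ ∈ Set.Ioo (0 : ℝ) 1, ∀ z ∈ S, ∀ x ∈ S,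
      p (twoPointExposure w μ z) x
        = (κ * r μ x + μ * (if x = z then 1 else 0)) / (μ + κ) := by
    intro μ hμ z hz x hx
    have hsum := sum_twoPointExposure hw hz μ
    have h := p_eq _ (exposure μ hμ z) (hsum.symm ▸ hμ) x hx
    rwa [hsum, twoPointExposure_of_mem hw hx] at h
  have composition : ∀ μ ∈ Set.Ioo (0 : ℝ) 1, ∀ z ∈ S, ∀ x ∈ S,
      twoPointExposure w μ z x / ∑ y ∈ S, twoPointExposure w μ z y
        = if x = z then 1 else 0 := by
    intro μ hμ z hz x hx
    rw [sum_twoPointExposure hw hz, twoPointExposure_of_mem hw hx,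
      mul_div_cancel_left₀ _ hμ.1.ne']
  have p_sub : ∀ μ ∈ Set.Ioo (0 : ℝ) 1, ∀ z ∈ S, ∀ x ∈ S,
      p (twoPointExposure w μ z) x - (if x = z then 1 else 0)
        = κ / (μ + κ) * (r μ x - if x = z then 1 else 0) := by
    intro μ hμ z hz x hx
    have hpos : 0 < μ + κ := add_pos hμ.1 hκ_pos
    rw [p_twoPoint μ hμ z hz x hx]
    field_simp
    ring
  have r_const : ∀ μ ∈ Set.Ioo (0 : ℝ) 1, ∀ x ∈ S, r μ x = r (1 / 2) x := by
    intro μ hμ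
    refine eq_of_collinear_from_vertices hcard fun z hz x hx y hy => ?_
    have h := hA2ii _ _ (exposure μ hμ z) (exposure _ half_mem z)
      ((sum_twoPointExposure hw hz μ).symm ▸ hμ)
      ((sum_twoPointExposure hw hz (1 / 2)).symm ▸ half_mem)
      (fun x hx => by rw [composition μ hμ z hz x hx, composition _ half_mem z hz x hx])
      x hx y hy
    rw [composition μ hμ z hz x hx, composition μ hμ z hz y hy, p_sub μ hμ z hz x hx,
      p_sub μ hμ z hz y hy, p_sub _ half_mem z hz x hx, p_sub _ half_mem z hz y hy] at h
    have hc₁ : κ / (μ + κ) ≠ 0 := (div_pos hκ_pos (add_pos hμ.1 hκ_pos)).ne'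
    have hc₂ : κ / (1 / 2 + κ) ≠ 0 := (div_pos hκ_pos (add_pos half_mem.1 hκ_pos)).ne'
    refine mul_left_cancel₀ (mul_ne_zero hc₁ hc₂) ?_
    linear_combination h
  have r_nonneg : ∀ x ∈ S, 0 ≤ r (1 / 2) x := by
    intro x hx
    obtain ⟨y, hy, hyx⟩ := Finset.exists_mem_ne (show 1 < S.card by omega) x
    have h := (hdist _ (exposure _ half_mem y)).1 x hx
    rw [p_twoPoint _ half_mem y hy x hx, if_neg hyx.symm, mul_zero, add_zero,
      le_div_iff₀ (add_pos half_mem.1 hκ_pos), zero_mul, mul_nonneg_iff_of_pos_left hκ_pos] at h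
    exact h
  have r_sum : ∑ x ∈ S, r (1 / 2) x = 1 := by
    simp_rw [hr]
    rw [← Finset.sum_div, Finset.sum_sub_distrib, ← Finset.mul_sum,
      (hdist _ (exposure _ half_mem s)).2, sum_twoPointExposure hw hs]
    field_simp
    ring
  refine ⟨1 / (1 + κ), ⟨by positivity, ?_⟩, r (1 / 2), r_nonneg, r_sum, ?_, ?_⟩
  · rw [div_lt_one (by positivity)]
    linarith
  · intro q hq hμ x hx
    have hpos : 0 < ∑ y ∈ S, q y + κ := add_pos hμ.1 hκ_pos
    have hden : 1 - 1 / (1 + κ) + 1 / (1 + κ) * ∑ y ∈ S, q y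
        = (∑ y ∈ S, q y + κ) / (1 + κ) := by
      field_simp
      ring
    rw [p_eq q hq hμ x hx, r_const _ hμ x hx, hden]
    field_simp
    ring
  · intro μ hμ
    rw [inv_lam μ hμ, add_sub_cancel_left]
end

section
/- Global AWLM characterization (Luce-consistent intrinsic family yields a single utility): Let X be a finite set with |X| ≥ 3. Suppose that for every subset S ⊆ X with |S| ≥ 3 there are given α_S ∈ (0,1) and a distribution p₀^S on S with p₀^S(x) > 0 for all x ∈ S, such that the observed rule satisfies p(x | S; q) = ((1-α_S)·p₀^S(x) + α_S·q(x)) / ((1-α_S) + α_S·q_S) for all exposures q and all x ∈ S. If (i) α_S = α is the same for all such S, and (ii) the family {p₀^S} is Luce-consistent, i.e. p₀^S(x)/p₀^S(y) = p₀^T(x)/p₀^T(y) for all S, T with |S|,|T| ≥ 3 and all x, y ∈ S ∩ T, then there exists u : X → ℝ with u(x) > 0 for all x such that for every S with |S| ≥ 3, every exposure q, and every x ∈ S, p(x | S; q) = ((1-α)·u(x)/∑_{z∈S} u(z) + α·q(x)) / ((1-α) + α·q_S). -/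
/-- A function on `S` of total mass one whose ratios to its value at a fixed `x` agree with those
of `u` equals the normalization of `u` at `x`. -/
theorem luce_share_eq {X : Type*} {S : Finset X} {f u : X → ℝ} {x : X}
    (hsum : ∑ z ∈ S, f z = 1) (hratio : ∀ z ∈ S, f z / f x = u z / u x) :
    f x = u x / ∑ z ∈ S, u z := by
  have h : (∑ z ∈ S, f z) / f x = (∑ z ∈ S, u z) / u x := by
    rw [Finset.sum_div, Finset.sum_div]
    exact Finset.sum_congr rfl hratio
  rw [hsum] at h
  rw [← inv_div, ← h, one_div, inv_inv]

/-- **Global AWLM characterization.** Suppose every menu `S` with `|S| ≥ 3` carries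
an AWLM representation with parameters `α_S ∈ (0,1)` and a strictly positive
intrinsic distribution `p₀^S`. If the influence indices are constant (`α_S = α`)
and the intrinsic family is Luce-consistent on overlaps, then there exists a single
utility `u : X → ℝ₊₊` representing all intrinsic distributions, so that the AWLM
formula holds with `p₀^S(x) = u(x)/∑_{z∈S} u(z)` on every such menu. -/
theorem global_AWLM_characterization
    {X : Type*} [Fintype X] [DecidableEq X] (hX : 3 ≤ Fintype.card X)
    (p : Finset X → (X → ℝ) → X → ℝ)
    (αf : Finset X → ℝ) (p0 : Finset X → X → ℝ)
    (hαf : ∀ S : Finset X, 3 ≤ S.card → αf S ∈ Set.Ioo (0 : ℝ) 1)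
    (hp0pos : ∀ S : Finset X, 3 ≤ S.card → ∀ x ∈ S, 0 < p0 S x)
    (hp0sum : ∀ S : Finset X, 3 ≤ S.card → ∑ x ∈ S, p0 S x = 1)
    (hrep : ∀ S : Finset X, 3 ≤ S.card → ∀ q : X → ℝ, IsExposure q → ∀ x ∈ S,
      p S q x = ((1 - αf S) * p0 S x + αf S * q x)
        / ((1 - αf S) + αf S * ∑ y ∈ S, q y))
    (α : ℝ) (hconst : ∀ S : Finset X, 3 ≤ S.card → αf S = α)
    (hLuce : ∀ S T : Finset X, 3 ≤ S.card → 3 ≤ T.card →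
      ∀ x ∈ S ∩ T, ∀ y ∈ S ∩ T, p0 S x / p0 S y = p0 T x / p0 T y) :
    ∃ u : X → ℝ, (∀ x, 0 < u x) ∧
      ∀ S : Finset X, 3 ≤ S.card → ∀ q : X → ℝ, IsExposure q → ∀ x ∈ S,
        p S q x = ((1 - α) * (u x / ∑ z ∈ S, u z) + α * q x)
          / ((1 - α) + α * ∑ y ∈ S, q y) := by
  have hU : 3 ≤ (Finset.univ : Finset X).card := hX
  refine ⟨p0 Finset.univ, fun x => hp0pos _ hU x (Finset.mem_univ x), ?_⟩
  intro S hS q hq x hx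
  rw [hrep S hS q hq x hx, hconst S hS,
    luce_share_eq (hp0sum S hS)
      (fun z hz => hLuce S Finset.univ hS hU z (by simpa using hz) x (by simpa using hx))]
end

section
/- Identification of α from two exposures: Fix a nonempty subset S of a finite set X, α ∈ (0,1), and a distribution p₀ on S. Let q₁, q₂ be exposures with induced AWLM choices P₁, P₂, and define Δ and A as usual. If A(x) ≠ 0 for some x ∈ S, then α = Δ(x)/A(x); in particular the ratio Δ(x)/A(x) is the same for all x ∈ S with A(x) ≠ 0. -/
/-- The denominator of the AWLM choice is positive when the feasible share is nonnegative. -/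
theorem awlm_denom_pos {α s : ℝ} (hα0 : 0 ≤ α) (hα1 : α < 1) (hs : 0 ≤ s) :
    0 < (1 - α) + α * s :=
  add_pos_of_pos_of_nonneg (sub_pos.mpr hα1) (mul_nonneg hα0 hs)

/-- **Identification of `α` from two exposures.** Under AWLM, with
`Δ(x) = P₂(x) - P₁(x)` and
`A(x) = (q₂(x) - q₁(x)) + (1 - q₂,S)·P₂(x) - (1 - q₁,S)·P₁(x)`, whenever
`A(x) ≠ 0` for some `x ∈ S` we have `α = Δ(x)/A(x)`; in particular this ratio is
the same for every `x ∈ S` with `A(x) ≠ 0`. -/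
theorem alpha_identification_from_two_exposures
    {X : Type*} [Fintype X] (S : Finset X) (hS : S.Nonempty)
    (α : ℝ) (hα0 : 0 < α) (hα1 : α < 1)
    (p0 : X → ℝ) (hp0nn : ∀ x ∈ S, 0 ≤ p0 x) (hp0sum : ∑ x ∈ S, p0 x = 1)
    (q₁ q₂ : X → ℝ)
    (hq₁nn : ∀ x, 0 ≤ q₁ x) (hq₁sum : ∑ x, q₁ x = 1)
    (hq₂nn : ∀ x, 0 ≤ q₂ x) (hq₂sum : ∑ x, q₂ x = 1)
    (P₁ P₂ : X → ℝ)
    (hP₁ : ∀ x ∈ S,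
      P₁ x = ((1 - α) * p0 x + α * q₁ x) / ((1 - α) + α * ∑ y ∈ S, q₁ y))
    (hP₂ : ∀ x ∈ S,
      P₂ x = ((1 - α) * p0 x + α * q₂ x) / ((1 - α) + α * ∑ y ∈ S, q₂ y)) :
    ∀ x ∈ S,
      ((q₂ x - q₁ x) + (1 - ∑ y ∈ S, q₂ y) * P₂ x - (1 - ∑ y ∈ S, q₁ y) * P₁ x) ≠ 0 →
      α = (P₂ x - P₁ x)
        / ((q₂ x - q₁ x) + (1 - ∑ y ∈ S, q₂ y) * P₂ x
            - (1 - ∑ y ∈ S, q₁ y) * P₁ x) := by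
  intro x hx hA
  have h₁ := (eq_div_iff (awlm_denom_pos hα0.le hα1
    (Finset.sum_nonneg fun y (_ : y ∈ S) => hq₁nn y)).ne').mp (hP₁ x hx)
  have h₂ := (eq_div_iff (awlm_denom_pos hα0.le hα1
    (Finset.sum_nonneg fun y (_ : y ∈ S) => hq₂nn y)).ne').mp (hP₂ x hx)
  rw [eq_div_iff hA]
  linear_combination h₁ - h₂
end

section
/- Finite-sample AWLM rationalizability: Fix a nonempty subset S of a finite set X, an integer K ≥ 1, exposures q₁, …, q_K on X, and distributions P₁, …, P_K on S. Then there exist α ∈ (0,1) and a distribution p₀ on S such that P_i(x) = ((1-α)·p₀(x) + α·q_i(x)) / ((1-α) + α·q_{i,S}) for all i and all x ∈ S, if and only if there exists α ∈ (0,1) such that (i) P_j(x) - P_i(x) = α·[(q_j(x) - q_i(x)) + (1 - q_{j,S})·P_j(x) - (1 - q_{i,S})·P_i(x)] for all 1 ≤ i < j ≤ K and all x ∈ S, and (ii) for some index i, the vector b_i(α)(x) := ((1-α) + α·q_{i,S})·P_i(x) - α·q_i(x) is nonnegative for all x ∈ S. In that case b₁(α) = ⋯ = b_K(α) = (1-α)·p₀,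 and p₀ is uniquely determined by p₀ = b_i(α)/(1-α) for any i. -/
/-- A distribution on a feasible set `S`: nonnegative on `S`, summing to one on `S`. -/
def IsDistOn {X : Type*} (S : Finset X) (p : X → ℝ) : Prop :=
  (∀ x ∈ S, 0 ≤ p x) ∧ ∑ x ∈ S, p x = 1

theorem IsExposure.luce_denominator_pos {X : Type*} [Fintype X] {q : X → ℝ} (hq : IsExposure q)
    (S : Finset X) {α : ℝ} (hα : α ∈ Set.Ioo (0 : ℝ) 1) :
    0 < (1 - α) + α * ∑ y ∈ S, q y := by
  have hsum : 0 ≤ ∑ y ∈ S, q y := Finset.sum_nonneg fun y _ => hq.1 y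
  have hmul := mul_nonneg hα.1.le hsum
  linarith [hα.2]

theorem IsDistOn.sum_residual {X : Type*} {S : Finset X} {P : X → ℝ} (hP : IsDistOn S P)
    (q : X → ℝ) (α : ℝ) :
    ∑ x ∈ S, (((1 - α) + α * ∑ y ∈ S, q y) * P x - α * q x) = 1 - α := by
  rw [Finset.sum_sub_distrib, ← Finset.mul_sum, ← Finset.mul_sum, hP.2]
  ring

/-- **Finite-sample AWLM rationalizability.** A dataset `{(qᵢ, Pᵢ)}` is generated by
a common AWLM with some `(α, p₀) ∈ (0,1) × Δ(S)` iff there is `α ∈ (0,1)` such that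
(i) the pairwise identities `Δᵢⱼ = α·Aᵢⱼ` all hold and (ii) `bᵢ(α) ≥ 0` on `S` for
some index `i`. In that case all `bᵢ(α)` coincide and equal `(1-α)·p₀`, so `p₀` is
uniquely determined. -/
theorem finite_sample_AWLM_rationalizability
    {X : Type*} [Fintype X] (S : Finset X) (hS : S.Nonempty)
    (K : ℕ) (hK : 1 ≤ K)
    (q : Fin K → X → ℝ) (hq : ∀ i, IsExposure (q i))
    (P : Fin K → X → ℝ) (hP : ∀ i, IsDistOn S (P i)) :
    ((∃ α ∈ Set.Ioo (0 : ℝ) 1, ∃ p0 : X → ℝ, IsDistOn S p0 ∧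
        ∀ i : Fin K, ∀ x ∈ S,
          P i x = ((1 - α) * p0 x + α * q i x) / ((1 - α) + α * ∑ y ∈ S, q i y))
      ↔
      (∃ α ∈ Set.Ioo (0 : ℝ) 1,
        (∀ i j : Fin K, i < j → ∀ x ∈ S,
          P j x - P i x
            = α * ((q j x - q i x)
                + (1 - ∑ y ∈ S, q j y) * P j x - (1 - ∑ y ∈ S, q i y) * P i x)) ∧
        (∃ i : Fin K, ∀ x ∈ S,
          0 ≤ ((1 - α) + α * ∑ y ∈ S, q i y) * P i x - α * q i x))) ∧
    (∀ α ∈ Set.Ioo (0 : ℝ) 1, ∀ p0 : X → ℝ, IsDistOn S p0 →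
      (∀ i : Fin K, ∀ x ∈ S,
        P i x = ((1 - α) * p0 x + α * q i x) / ((1 - α) + α * ∑ y ∈ S, q i y)) →
      ∀ i : Fin K, ∀ x ∈ S,
        ((1 - α) + α * ∑ y ∈ S, q i y) * P i x - α * q i x = (1 - α) * p0 x) := by
  have residual_eq : ∀ α ∈ Set.Ioo (0 : ℝ) 1, ∀ p0 : X → ℝ, ∀ i : Fin K, ∀ x ∈ S,
      P i x = ((1 - α) * p0 x + α * q i x) / ((1 - α) + α * ∑ y ∈ S, q i y) ↔
      ((1 - α) + α * ∑ y ∈ S, q i y) * P i x - α * q i x = (1 - α) * p0 x := by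
    intro α hα p0 i x _
    rw [eq_div_iff ((hq i).luce_denominator_pos S hα).ne', mul_comm (P i x), sub_eq_iff_eq_add]
  refine ⟨⟨?_, ?_⟩, fun α hα p0 _ h i x hx => (residual_eq α hα p0 i x hx).1 (h i x hx)⟩
  · rintro ⟨α, hα, p0, hp0, h⟩
    have hb := fun i x hx => (residual_eq α hα p0 i x hx).1 (h i x hx)
    refine ⟨α, hα, fun i j _ x hx => ?_, ⟨0, hK⟩, fun x hx => ?_⟩
    · linear_combination hb j x hx - hb i x hx
    · rw [hb _ x hx]
      exact mul_nonneg (sub_nonneg.2 hα.2.le) (hp0.1 x hx)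
  · rintro ⟨α, hα, hpair, i, hi⟩
    have hpos : 0 < 1 - α := sub_pos.2 hα.2
    refine ⟨α, hα, fun x => (((1 - α) + α * ∑ y ∈ S, q i y) * P i x - α * q i x) / (1 - α),
      ⟨fun x hx => div_nonneg (hi x hx) hpos.le, ?_⟩, fun j x hx => ?_⟩
    · rw [← Finset.sum_div, (hP i).sum_residual, div_self hpos.ne']
    · apply (residual_eq α hα _ j x hx).2
      rw [mul_div_cancel₀ _ hpos.ne']
      rcases lt_trichotomy i j with hij | rfl | hji
      · linear_combination hpair i j hij x hx
      · rfl
      · linear_combination -hpair j i hji x hx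
end

section
/- Injectivity of the AWLM parameter map for non-collinear designs: Fix a nonempty subset S of a finite set X and exposures q₁, …, q_K on X (K ≥ 3) whose restrictions v_i := q_i|_S do not all lie on a common affine line in ℝ^S, i.e. there exist indices i, j, k such that v_j − v_i and v_k − v_i are linearly independent. Suppose α, α' ∈ (0,1) and distributions p₀, p₀' on S satisfy p(x | S; q_i, α; p₀) = p(x | S; q_i, α'; p₀') for all i = 1, …, K and all x ∈ S. Then α = α' and p₀(x) = p₀'(x) for all x ∈ S. -/
/-- Cross-multiplied form of the equality of two AWLM choice probabilities: an affine relation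
in the exposure `v` of the alternative and the feasible share `s`. -/
lemma affine_relation_of_choice_eq {α α' s p p' v : ℝ} (hα : α ∈ Set.Ioo (0 : ℝ) 1)
    (hα' : α' ∈ Set.Ioo (0 : ℝ) 1) (hs : 0 ≤ s)
    (h : ((1 - α) * p + α * v) / ((1 - α) + α * s)
      = ((1 - α') * p' + α' * v) / ((1 - α') + α' * s)) :
    (1 - α) * (1 - α') * (p - p') + (α - α') * v
      + s * ((1 - α) * α' * p - (1 - α') * α * p') = 0 := by
  have hD : (1 - α) + α * s ≠ 0 := by
    nlinarith [mul_nonneg hα.1.le hs, hα.2]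
  have hD' : (1 - α') + α' * s ≠ 0 := by
    nlinarith [mul_nonneg hα'.1.le hs, hα'.2]
  rw [div_eq_div_iff hD hD'] at h
  linear_combination h

/-- Three vectors `u, v, w` satisfying `A + c • v + s • B = 0` for scalars `s` of their own
are collinear unless `c = 0`. -/
lemma eq_zero_of_affine_relation {ι : Type*} {u v w A B : ι → ℝ} {c r s t : ℝ}
    (hu : ∀ x, A x + c * u x + r * B x = 0) (hv : ∀ x, A x + c * v x + s * B x = 0)
    (hw : ∀ x, A x + c * w x + t * B x = 0)
    (hli : LinearIndependent ℝ ![fun x => v x - u x, fun x => w x - u x]) : c = 0 := by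
  by_contra hc
  have hpair := LinearIndependent.pair_iff.mp hli
  have hts : t - r = 0 := by
    refine (hpair (t - r) (-(s - r)) ?_).1
    funext x
    refine (mul_eq_zero.mp ?_).resolve_left hc
    simp only [Pi.add_apply, Pi.smul_apply, smul_eq_mul]
    linear_combination (t - r) * (hv x - hu x) - (s - r) * (hw x - hu x)
  refine hc (hpair 0 c ?_).2
  funext x
  simp only [Pi.add_apply, Pi.smul_apply, smul_eq_mul, Pi.zero_apply]
  linear_combination hw x - hu x - B x * hts

/-- **Injectivity of the AWLM parameter map for non-collinear designs.** If the
restrictions `qᵢ|_S` of the exposures do not all lie on a common affine line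
(witnessed by indices `i, j, k` with `q_j|_S − q_i|_S` and `q_k|_S − q_i|_S`
linearly independent), then two AWLM parameterizations `(α, p₀)` and `(α', p₀')`
inducing the same choices under every exposure `qᵢ` must coincide. -/
theorem AWLM_parameter_injectivity
    {X : Type*} [Fintype X] (S : Finset X) (hS : S.Nonempty)
    (K : ℕ) (hK : 3 ≤ K)
    (q : Fin K → X → ℝ) (hq : ∀ i, IsExposure (q i))
    (hnc : ∃ i j k : Fin K, LinearIndependent ℝ
      ![fun x : {x // x ∈ S} => q j x.1 - q i x.1,
        fun x : {x // x ∈ S} => q k x.1 - q i x.1])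
    (α α' : ℝ) (hα : α ∈ Set.Ioo (0 : ℝ) 1) (hα' : α' ∈ Set.Ioo (0 : ℝ) 1)
    (p0 p0' : X → ℝ) (hp0 : IsDistOn S p0) (hp0' : IsDistOn S p0')
    (heq : ∀ i : Fin K, ∀ x ∈ S,
      ((1 - α) * p0 x + α * q i x) / ((1 - α) + α * ∑ y ∈ S, q i y)
        = ((1 - α') * p0' x + α' * q i x) / ((1 - α') + α' * ∑ y ∈ S, q i y)) :
    α = α' ∧ ∀ x ∈ S, p0 x = p0' x := by
  have hs : ∀ i, 0 ≤ ∑ y ∈ S, q i y := fun i => Finset.sum_nonneg fun y _ => (hq i).1 y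
  have hrel := fun i x hx => affine_relation_of_choice_eq hα hα' (hs i) (heq i x hx)
  obtain ⟨i, j, k, hli⟩ := hnc
  have hc : α - α' = 0 :=
    eq_zero_of_affine_relation (fun x : {x // x ∈ S} => hrel i x.1 x.2)
      (fun x => hrel j x.1 x.2) (fun x => hrel k x.1 x.2) hli
  obtain rfl := sub_eq_zero.mp hc
  refine ⟨rfl, fun x hx => ?_⟩
  have ha : 0 < 1 - α := sub_pos.mpr hα.2
  have hD : 0 < (1 - α) * ((1 - α) + α * ∑ y ∈ S, q i y) :=
    mul_pos ha (add_pos_of_pos_of_nonneg ha (mul_nonneg hα.1.le (hs i)))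
  refine sub_eq_zero.mp ((mul_eq_zero.mp ?_).resolve_left hD.ne')
  linear_combination hrel i x hx
end

section
/- Genericity of non-collinear exposure designs: Let X be a finite set, S ⊆ X a subset with |S| ≥ 2, I a subset of X with S ⊊ I, and K ≥ 3. Let Δ(I) ⊆ ℝ^X be the set of exposures supported on I (q ≥ 0, ∑_{x∈X} q(x) = 1, q(x) = 0 for x ∉ I), with the subspace topology from ℝ^X, and give Δ(I)^K the product topology. Let Q* be the set of profiles (q₁, …, q_K) ∈ Δ(I)^K such that the restrictions v_i := q_i|_S ∈ ℝ^S do not all lie on a common affine line, i.e. there exist indices i, j, k with v_j − v_i and v_k − v_i linearly independent. Then Q* is open and dense in Δ(I)^K. -/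
/-- An exposure supported on `I ⊆ X`: nonnegative, summing to one over `X`, and
vanishing outside `I`. -/
def IsExposureOn {X : Type*} [Fintype X] (I : Finset X) (q : X → ℝ) : Prop :=
  (∀ x, 0 ≤ q x) ∧ (∑ x, q x = 1) ∧ ∀ x ∉ I, q x = 0

open Filter Topology

/-- A pair of real vectors with a nonvanishing `2 × 2` minor is linearly independent. -/
theorem linearIndependent_pair_of_minor_ne_zero {ι : Type*} {v w : ι → ℝ} (a b : ι)
    (h : v a * w b - v b * w a ≠ 0) : LinearIndependent ℝ ![v, w] := by
  rw [LinearIndependent.pair_iff]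
  intro s t hst
  have ha : s * v a + t * w a = 0 := by simpa using congrFun hst a
  have hb : s * v b + t * w b = 0 := by simpa using congrFun hst b
  constructor
  · refine (mul_eq_zero.mp ?_).resolve_right h
    linear_combination w b * ha - w a * hb
  · refine (mul_eq_zero.mp ?_).resolve_right h
    linear_combination v a * hb - v b * ha

/-- A nonzero real polynomial has no roots on a small punctured right neighbourhood of a point. -/
theorem Polynomial.eventually_nhdsGT_eval_ne_zero {P : Polynomial ℝ} (hP : P ≠ 0) (x : ℝ) :
    ∀ᶠ t in 𝓝[>] x, P.eval t ≠ 0 := by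
  have hfin : ({t | P.IsRoot t} \ {x}).Finite := (P.finite_setOfPred_isRoot hP).sdiff
  have hmem : ({t | P.IsRoot t} \ {x})ᶜ ∈ 𝓝 x :=
    hfin.isClosed.isOpen_compl.mem_nhds (by simp)
  filter_upwards [mem_nhdsWithin_of_mem_nhds hmem, self_mem_nhdsWithin] with t ht hxt hroot
  exact ht ⟨hroot, ne_of_gt (Set.mem_Ioi.mp hxt)⟩

/-- A point mass at a point of `I` is an exposure supported on `I`. -/
theorem isExposureOn_single {X : Type*} [Fintype X] [DecidableEq X] {I : Finset X} {x : X}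
    (hx : x ∈ I) : IsExposureOn I (Pi.single x (1 : ℝ)) := by
  refine ⟨fun y => ?_, by simp, fun y hy => ?_⟩
  · by_cases h : y = x
    · subst h; simp
    · simp [h]
  · have h : y ≠ x := fun h => hy (h ▸ hx)
    simp [h]

/-- Exposures supported on `I` are closed under convex combinations. -/
theorem IsExposureOn.convexComb {X : Type*} [Fintype X] {I : Finset X} {p q : X → ℝ}
    (hp : IsExposureOn I p) (hq : IsExposureOn I q) {t : ℝ} (h0 : 0 ≤ t) (h1 : t ≤ 1) :
    IsExposureOn I fun x => (1 - t) * q x + t * p x := by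
  refine ⟨fun x => ?_, ?_, fun x hx => ?_⟩
  · exact add_nonneg (mul_nonneg (sub_nonneg.mpr h1) (hq.1 x)) (mul_nonneg h0 (hp.1 x))
  · rw [Finset.sum_add_distrib, ← Finset.mul_sum, ← Finset.mul_sum, hq.2.1, hp.2.1]
    ring
  · simp [hp.2.2 x hx, hq.2.2 x hx]

/-- **Genericity of non-collinear exposure designs.** Let `S ⊆ X` with `|S| ≥ 2`,
`S ⊊ I ⊆ X`, and `K ≥ 3`. Within the space `Δ(I)^K` of `K`-tuples of exposures
supported on `I` (with the product of subspace topologies from `ℝ^X`), the set `Q*`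
of profiles whose restrictions `qᵢ|_S ∈ ℝ^S` do not all lie on a common affine line
(i.e. some `q_j|_S − q_i|_S` and `q_k|_S − q_i|_S` are linearly independent) is open
and dense. -/
theorem generic_noncollinear_designs
    {X : Type*} [Fintype X] (S I : Finset X)
    (hScard : 2 ≤ S.card) (hSI : S ⊂ I)
    (K : ℕ) (hK : 3 ≤ K) :
    IsOpen {q : {q : Fin K → X → ℝ // ∀ i, IsExposureOn I (q i)} |
        ∃ i j k : Fin K, LinearIndependent ℝ
          ![fun x : {x // x ∈ S} => q.1 j x.1 - q.1 i x.1,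
            fun x : {x // x ∈ S} => q.1 k x.1 - q.1 i x.1]} ∧
    Dense {q : {q : Fin K → X → ℝ // ∀ i, IsExposureOn I (q i)} |
        ∃ i j k : Fin K, LinearIndependent ℝ
          ![fun x : {x // x ∈ S} => q.1 j x.1 - q.1 i x.1,
            fun x : {x // x ∈ S} => q.1 k x.1 - q.1 i x.1]} := by
  classical
  constructor
  · simp only [Set.ofPred_exists]
    refine isOpen_iUnion fun i => isOpen_iUnion fun j => isOpen_iUnion fun k => ?_
    refine (isOpen_setOfPred_linearIndependent (𝕜 := ℝ) (ι := Fin 2)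
      (E := {x // x ∈ S} → ℝ)).preimage
      (f := fun q : {q : Fin K → X → ℝ // ∀ i, IsExposureOn I (q i)} =>
        ![fun x : {x // x ∈ S} => q.1 j x.1 - q.1 i x.1,
          fun x : {x // x ∈ S} => q.1 k x.1 - q.1 i x.1]) ?_
    refine continuous_pi fun m => continuous_pi fun x => ?_
    have hcoord : ∀ l, Continuous
        fun q : {q : Fin K → X → ℝ // ∀ i, IsExposureOn I (q i)} => q.1 l x.1 := fun l =>
      (continuous_apply_apply l x.1).comp continuous_subtype_val
    fin_cases m
    exacts [(hcoord j).sub (hcoord i), (hcoord k).sub (hcoord i)]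
  · obtain ⟨a, ha, b, hb, hab⟩ := Finset.one_lt_card.mp hScard
    obtain ⟨c, hcI, hcS⟩ := Finset.exists_of_ssubset hSI
    have hac : a ≠ c := fun h => hcS (h ▸ ha)
    have hbc : b ≠ c := fun h => hcS (h ▸ hb)
    let i₀ : Fin K := ⟨0, by omega⟩
    let i₁ : Fin K := ⟨1, by omega⟩
    let i₂ : Fin K := ⟨2, by omega⟩
    let site : Fin K → X := fun i => if i = i₀ then c else if i = i₁ then a else b
    have hsite : ∀ i, site i ∈ I := by
      intro i
      simp only [site]
      split_ifs
      exacts [hcI, hSI.1 ha, hSI.1 hb]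
    have hs₀ : site i₀ = c := by simp [site]
    have hs₁ : site i₁ = a := by simp [site, i₀, i₁]
    have hs₂ : site i₂ = b := by simp [site, i₀, i₁, i₂]
    intro q
    let clamp : ℝ → ℝ := fun t => max 0 (min 1 t)
    let path : ℝ → {q : Fin K → X → ℝ // ∀ i, IsExposureOn I (q i)} := fun t =>
      ⟨fun i x => (1 - clamp t) * q.1 i x + clamp t * (Pi.single (site i) 1 : X → ℝ) x,
        fun i => (isExposureOn_single (hsite i)).convexComb (q.2 i)
          (le_max_left _ _) (max_le zero_le_one (min_le_left _ _))⟩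
    have hpath : Continuous path := by
      refine Continuous.subtype_mk ?_ _
      simp only [clamp]
      fun_prop
    have hpath0 : path 0 = q := by
      ext i x
      simp [path, clamp]
    have htend : Tendsto path (𝓝[>] 0) (𝓝 q) := by
      have h := hpath.tendsto 0
      rw [hpath0] at h
      exact h.mono_left nhdsWithin_le_nhds
    refine mem_closure_of_tendsto htend ?_
    let line : Fin K → X → ℝ → Polynomial ℝ := fun i x e =>
      (1 - .X) * .C (q.1 i x - q.1 i₀ x) + .X * .C e
    let P : Polynomial ℝ := line i₁ a 1 * line i₂ b 1 - line i₁ b 0 * line i₂ a 0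
    have hP : P ≠ 0 := by
      intro h
      simpa [P, line] using congrArg (Polynomial.eval 1) h
    filter_upwards [Polynomial.eventually_nhdsGT_eval_ne_zero hP 0,
      Ioo_mem_nhdsGT (zero_lt_one' ℝ)] with t ht ht01
    have hclamp : clamp t = t := by
      simp only [clamp]
      rw [min_eq_right ht01.2.le, max_eq_right ht01.1.le]
    refine ⟨i₀, i₁, i₂, linearIndependent_pair_of_minor_ne_zero ⟨a, ha⟩ ⟨b, hb⟩ ?_⟩
    convert ht using 1
    simp [path, hclamp, hs₀, hs₁, hs₂, P, line, hab, hab.symm, hac, hbc]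
    ring
end
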